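/- Let P : ℝ³ → ℝ be a twice continuously differentiable convex function with |∇P(x)| ≤ d for all x ∈ ℝ³, and let K > 4 and M ≥ 1. Then ∫_{{|x| > M}} |x|^{−K/2} ΔP(x) dx ≤ 4π d K/(K − 4). -/

import Mathlib

open MeasureTheory
abbrev E3 := EuclideanSpace ℝ (Fin 3)

theorem aux_second_nonneg (P : E3 → ℝ) (hP : ContDiff ℝ 2 P) (hconv : ConvexOn ℝ Set.univ P)
    (x v : E3) : 0 ≤ fderiv ℝ (fun y => fderiv ℝ P y v) x v := by
  have hu : ContDiff ℝ 1 (fun y => fderiv ℝ P y v) :=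
    (hP.fderiv_right (m := 1) (by norm_num)).clm_apply contDiff_const
  have hline : ∀ t : ℝ, HasDerivAt (fun t : ℝ => x + t • v) v t := by
    intro t
    simpa using ((hasDerivAt_id t).smul_const v).const_add x
  have h1 : ∀ t : ℝ, HasDerivAt (fun t : ℝ => P (x + t • v)) (fderiv ℝ P (x + t • v) v) t := by
    intro t
    exact ((hP.differentiable (by norm_num)) (x + t • v)).hasFDerivAt.comp_hasDerivAt t (hline t)
  have hc : ConvexOn ℝ Set.univ (fun t : ℝ => P (x + t • v)) := by
    refine ⟨convex_univ, ?_⟩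
    intro a _ b _ p q hp hq hpq
    have := hconv.2 (Set.mem_univ (x + a • v)) (Set.mem_univ (x + b • v)) hp hq hpq
    convert this using 2
    have : x = (p + q) • x := by rw [hpq, one_smul]
    nth_rewrite 1 [this]
    simp only [smul_eq_mul]
    module
  have hm := hc.monotoneOn_deriv (fun t _ => (h1 t).differentiableAt)
  have hd : deriv (fun t : ℝ => P (x + t • v)) = fun t => fderiv ℝ P (x + t • v) v :=
    funext fun t => (h1 t).deriv
  rw [hd] at hm
  have hm' : Monotone (fun t : ℝ => fderiv ℝ P (x + t • v) v) := fun a b hab =>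
    hm (Set.mem_univ a) (Set.mem_univ b) hab
  have h2 : HasDerivAt (fun t : ℝ => fderiv ℝ P (x + t • v) v)
      (fderiv ℝ (fun y => fderiv ℝ P y v) x v) 0 := by
    have := ((hu.differentiable (by norm_num)) (x + (0:ℝ) • v)).hasFDerivAt.comp_hasDerivAt 0 (hline 0)
    simpa [Function.comp_def] using this
  rw [← h2.deriv]
  exact hm'.deriv_nonneg

theorem aux_ibp (u g : E3 → ℝ) (hu : ContDiff ℝ 1 u) {D : NNReal} (hg : LipschitzWith D g)
    (hgc : HasCompactSupport g) (v : E3) :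
    Integrable (fun x => fderiv ℝ u x v * g x) ∧ Integrable (fun x => lineDeriv ℝ g x v * u x) ∧
    ∫ x, fderiv ℝ u x v * g x = - ∫ x, lineDeriv ℝ g x v * u x := by
  obtain ⟨ρ, hρ0, hρ⟩ := hgc.isCompact.isBounded.subset_ball_lt 0 0
  let χ : ContDiffBump (0 : E3) := ⟨ρ, ρ + 1, hρ0, by linarith⟩
  let f : E3 → ℝ := fun x => χ x * u x
  have hf : ContDiff ℝ 1 f := χ.contDiff.mul hu
  have hfc : HasCompactSupport f := χ.hasCompactSupport.mul_right
  obtain ⟨C, hC⟩ := ContDiff.lipschitzWith_of_hasCompactSupport hfc hf (by norm_num)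
  have hfu : ∀ x ∈ tsupport g, f =ᶠ[nhds x] u := by
    intro x hx
    filter_upwards [χ.eventuallyEq_one_of_mem_ball (hρ hx)] with y hy
    simp [f, hy]
  have e1 : (fun x => lineDeriv ℝ f x v * g x) = fun x => fderiv ℝ u x v * g x := by
    funext x
    by_cases hx : x ∈ tsupport g
    · rw [((hf.differentiable (by norm_num)) x).lineDeriv_eq_fderiv, (hfu x hx).fderiv_eq]
    · rw [image_eq_zero_of_notMem_tsupport hx]; simp
  have e2 : (fun x => lineDeriv ℝ g x v * f x) = fun x => lineDeriv ℝ g x v * u x := by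
    funext x
    by_cases hx : x ∈ tsupport g
    · rw [(hfu x hx).eq_of_nhds]
    · have : g =ᶠ[nhds x] fun _ => 0 := notMem_tsupport_iff_eventuallyEq.1 hx
      rw [this.lineDeriv_eq]; simp [lineDeriv]
  have key := LipschitzWith.integral_lineDeriv_mul_eq (μ := volume) hC hg hgc v
  simp only [lineDeriv_neg, neg_mul, integral_neg] at key
  rw [e1, e2] at key
  refine ⟨?_, ?_, key⟩
  · apply Continuous.integrable_of_hasCompactSupport
    · exact ((hu.continuous_fderiv (by norm_num)).clm_apply continuous_const).mul hg.continuous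
    · exact hgc.mul_left
  · rw [← e2]
    refine Integrable.bdd_mul (c := D * ‖v‖) (hf.continuous.integrable_of_hasCompactSupport hfc)
      (measurable_lineDeriv hg.continuous).aestronglyMeasurable ?_
    exact Filter.Eventually.of_forall fun x => norm_lineDeriv_le_of_lipschitz ℝ hg

theorem aux_radial (k M R : ℝ) (hk : 2 < k) (hM : 1 ≤ M) :
    Integrable (fun x : E3 => (Set.Ioo M R).indicator (fun t => k * t ^ (-k - 1)) ‖x‖) ∧
    ∫ x : E3, (Set.Ioo M R).indicator (fun t => k * t ^ (-k - 1)) ‖x‖ ≤ 4 * Real.pi * (k / (k - 2)) := by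
  have e : ∀ y : ℝ, y ^ 2 • (Set.Ioo M R).indicator (fun t => k * t ^ (-k - 1)) y
      = (Set.Ioo M R).indicator (fun t => k * t ^ (1 - k)) y := by
    intro y
    by_cases hy : y ∈ Set.Ioo M R
    · have : 0 < y := by linarith [hy.1]
      simp only [Set.indicator_of_mem hy, smul_eq_mul]
      rw [show (1 - k) = 2 + (-k - 1) by ring, Real.rpow_add this]
      norm_cast; ring
    · simp [hy]
  have hi : IntegrableOn (fun t : ℝ => k * t ^ (1 - k)) (Set.Ioi 1) :=
    (integrableOn_Ioi_rpow_of_lt (by linarith) one_pos).const_mul k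
  have hsub : Set.Ioo M R ⊆ Set.Ioi 1 := fun y hy => lt_of_le_of_lt hM hy.1
  constructor
  · rw [integrable_fun_norm_addHaar]
    simp only [finrank_euclideanSpace, Fintype.card_fin, Nat.add_one_sub_one, e]
    apply Integrable.integrableOn
    rw [integrable_indicator_iff measurableSet_Ioo]
    exact hi.mono_set hsub
  · rw [integral_fun_norm_addHaar]
    simp only [finrank_euclideanSpace, Fintype.card_fin, Nat.add_one_sub_one, e]
    have hv : volume.real (Metric.ball (0 : E3) 1) = Real.pi * 4 / 3 := by
      rw [measureReal_def, EuclideanSpace.volume_ball_fin_three]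
      simp
      positivity
    have hint : ∫ y in Set.Ioi (0:ℝ), (Set.Ioo M R).indicator (fun t => k * t ^ (1 - k)) y
        ≤ k / (k - 2) := by
      rw [setIntegral_indicator measurableSet_Ioo]
      have h1 : ∫ t in Set.Ioi (1:ℝ), k * t ^ (1 - k) = k / (k - 2) := by
        rw [integral_const_mul, integral_Ioi_rpow_of_lt (by linarith) one_pos]
        rw [Real.one_rpow, show (1 - k + 1) = - (k - 2) by ring, neg_div_neg_eq]
        ring
      rw [← h1]
      apply setIntegral_mono_set hi
      · refine (ae_restrict_iff' measurableSet_Ioi).2 (Filter.Eventually.of_forall fun t ht => ?_)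
        have : (0:ℝ) < t := lt_trans one_pos ht
        simp only [Pi.zero_apply]; positivity
      · exact (Set.inter_subset_right.trans hsub).eventuallyLE
    rw [hv, nsmul_eq_mul, smul_eq_mul]
    have := mul_le_mul_of_nonneg_left hint (by positivity : 0 ≤ 4 * Real.pi)
    push_cast
    linarith

theorem aux_lip (k M R : ℝ) (hk : 2 < k) (hM : 1 ≤ M) :
    LipschitzWith k.toNNReal (fun x : E3 => (max M (min ‖x‖ R)) ^ (-k) - R ^ (-k)) := by
  have h1 : LipschitzOnWith k.toNNReal (fun t : ℝ => t ^ (-k) - R ^ (-k)) (Set.Ici 1) := by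
    apply (convex_Ici (1:ℝ)).lipschitzOnWith_of_nnnorm_hasDerivWithin_le
      (f' := fun t => (-k) * t ^ (-k - 1))
    · intro t ht
      have : t ≠ 0 := by have : (1:ℝ) ≤ t := ht; positivity
      exact ((Real.hasDerivAt_rpow_const (Or.inl this)).sub_const _).hasDerivWithinAt
    · intro t ht
      have ht : (1:ℝ) ≤ t := ht
      rw [← NNReal.coe_le_coe, coe_nnnorm, Real.coe_toNNReal k (by linarith)]
      change ‖-k * t ^ (-k - 1)‖ ≤ k
      rw [norm_mul, norm_neg, Real.norm_of_nonneg (by linarith : 0 ≤ k),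
        Real.norm_of_nonneg (by positivity)]
      have := Real.rpow_le_one_of_one_le_of_nonpos ht (by linarith : -k - 1 ≤ 0)
      nlinarith
  have h2 : LipschitzWith 1 (fun x : E3 => max M (min ‖x‖ R)) :=
    (lipschitzWith_one_norm.min_const R).const_max M
  have := h1.comp (h2.lipschitzOnWith (s := Set.univ)) (fun x _ => le_trans hM (le_max_left _ _))
  rw [lipschitzOnWith_univ, mul_one] at this
  exact this

theorem aux_main (P : E3 → ℝ) (hP : ContDiff ℝ 2 P) (hconv : ConvexOn ℝ Set.univ P)
    (d : ℝ) (hgrad : ∀ x, ‖gradient P x‖ ≤ d) (k M R : ℝ) (hk : 2 < k) (hM : 1 ≤ M) (hR : M < R) :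
    ∫ x in {x : E3 | M < ‖x‖}, ((max M (min ‖x‖ R)) ^ (-k) - R ^ (-k)) *
        ∑ i : Fin 3, fderiv ℝ (fun y => fderiv ℝ P y (EuclideanSpace.single i 1)) x
            (EuclideanSpace.single i 1) ≤ 4 * Real.pi * d * (k / (k - 2)) := by
  set g : E3 → ℝ := fun x => (max M (min ‖x‖ R)) ^ (-k) - R ^ (-k) with hgdef
  set e : Fin 3 → E3 := fun i => EuclideanSpace.single i 1 with he
  set u : Fin 3 → E3 → ℝ := fun i y => fderiv ℝ P y (e i) with hudef
  have hM0 : 0 < M := by linarith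
  have hd0 : 0 ≤ d := le_trans (norm_nonneg _) (hgrad 0)
  have hglip := aux_lip k M R hk hM
  have hu : ∀ i, ContDiff ℝ 1 (u i) := fun i =>
    (hP.fderiv_right (m := 1) (by norm_num)).clm_apply contDiff_const
  have hgR : ∀ x : E3, R ≤ ‖x‖ → g x = 0 := by
    intro x hx
    simp [hgdef, min_eq_right hx, max_eq_right hR.le]
  have hg0 : ∀ x, 0 ≤ g x := by
    intro x
    have : (max M (min ‖x‖ R)) ≤ R := max_le hR.le (min_le_right _ _)
    have h2 := Real.rpow_le_rpow_of_nonpos (lt_of_lt_of_le hM0 (le_max_left M (min ‖x‖ R))) this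
      (by linarith : -k ≤ 0)
    simp only [hgdef]; linarith
  have hgc : HasCompactSupport g := by
    apply HasCompactSupport.intro (isCompact_closedBall (0:E3) R)
    intro x hx
    apply hgR
    simp at hx
    exact hx.le
  have hibp := fun i => aux_ibp (u i) g (hu i) hglip hgc (e i)
  have hneg : ∀ i, Integrable (fun x => -(lineDeriv ℝ g x (e i) * u i x)) :=
    fun i => (hibp i).2.1.neg
  have hL0 : ∀ x, 0 ≤ ∑ i, fderiv ℝ (u i) x (e i) := fun x =>
    Finset.sum_nonneg fun i _ => aux_second_nonneg P hP hconv x (e i)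
  have hsumeq : (fun x => g x * ∑ i, fderiv ℝ (u i) x (e i))
      = fun x => ∑ i, fderiv ℝ (u i) x (e i) * g x := by
    funext x
    rw [mul_comm, Finset.sum_mul]
  have hint : Integrable (fun x => g x * ∑ i, fderiv ℝ (u i) x (e i)) := by
    rw [hsumeq]
    exact integrable_finsetSum _ fun i _ => (hibp i).1
  obtain ⟨hri, hr⟩ := aux_radial k M R hk hM
  calc ∫ x in {x : E3 | M < ‖x‖}, g x * ∑ i, fderiv ℝ (u i) x (e i)
      ≤ ∫ x, g x * ∑ i, fderiv ℝ (u i) x (e i) :=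
        setIntegral_le_integral hint
          (Filter.Eventually.of_forall fun x => mul_nonneg (hg0 x) (hL0 x))
    _ = ∑ i, ∫ x, fderiv ℝ (u i) x (e i) * g x := by
        rw [hsumeq, integral_finsetSum _ fun i _ => (hibp i).1]
    _ = ∑ i, ∫ x, -(lineDeriv ℝ g x (e i) * u i x) := by
        refine Finset.sum_congr rfl fun i _ => ?_
        rw [(hibp i).2.2, integral_neg]
    _ = ∫ x, ∑ i, -(lineDeriv ℝ g x (e i) * u i x) := by
        rw [integral_finsetSum _ fun i _ => hneg i]
    _ ≤ ∫ x : E3, d * (Set.Ioo M R).indicator (fun t => k * t ^ (-k - 1)) ‖x‖ := by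
        apply integral_mono_ae (integrable_finsetSum _ fun i _ => hneg i) (hri.const_mul d)
        have hs1 : ∀ᵐ x : E3, x ∉ Metric.sphere (0:E3) M :=
          measure_eq_zero_iff_ae_notMem.1 (Measure.addHaar_sphere volume 0 M)
        have hs2 : ∀ᵐ x : E3, x ∉ Metric.sphere (0:E3) R :=
          measure_eq_zero_iff_ae_notMem.1 (Measure.addHaar_sphere volume 0 R)
        filter_upwards [hs1, hs2] with x hx1 hx2
        simp only [mem_sphere_iff_norm, sub_zero] at hx1 hx2
        have hconst : ∀ c : ℝ, g =ᶠ[nhds x] (fun _ => c) →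
            ∑ i, -(lineDeriv ℝ g x (e i) * u i x) = 0 := by
          intro c hc
          refine Finset.sum_eq_zero fun i _ => ?_
          rw [hc.lineDeriv_eq]; simp [lineDeriv]
        rcases lt_or_gt_of_ne hx1 with h1 | h1
        · have : x ∉ {x : E3 | ‖x‖ ∈ Set.Ioo M R} := fun h => lt_asymm h1 h.1
          rw [hconst (M ^ (-k) - R ^ (-k))]
          · rw [Set.indicator_of_notMem (fun h => lt_asymm h1 h.1)]; simp
          · filter_upwards [continuous_norm.continuousAt.eventually_lt continuousAt_const h1]
              with y hy
            simp only [hgdef]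
            rw [max_eq_left ((min_le_left _ _).trans hy.le)]
        rcases lt_or_gt_of_ne hx2 with h2 | h2
        · rw [Set.indicator_of_mem (show ‖x‖ ∈ Set.Ioo M R from ⟨h1, h2⟩)]
          have hx0 : x ≠ 0 := by
            intro h; rw [h, norm_zero] at h1; linarith
          have hnd : DifferentiableAt ℝ (fun y : E3 => ‖y‖) x :=
            differentiableAt_id.norm ℝ hx0
          have hgloc : g =ᶠ[nhds x] fun y => ‖y‖ ^ (-k) - R ^ (-k) := by
            filter_upwards [continuous_norm.continuousAt.eventually_lt continuousAt_const h2,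
              continuousAt_const.eventually_lt continuous_norm.continuousAt h1] with y hy hy'
            simp only [hgdef]
            rw [min_eq_left hy.le, max_eq_right hy'.le]
          have hder : HasFDerivAt g ((-k * ‖x‖ ^ (-k - 1)) • fderiv ℝ (fun y : E3 => ‖y‖) x) x := by
            refine HasFDerivAt.congr_of_eventuallyEq ?_ hgloc
            refine HasFDerivAt.sub_const _ ?_
            exact (Real.hasDerivAt_rpow_const (Or.inl (norm_ne_zero_iff.2 hx0))).comp_hasFDerivAt x
              hnd.hasFDerivAt
          have hpu : ∀ i, u i x = (gradient P x) i := by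
            intro i
            have : u i x = inner ℝ (gradient P x) (e i) := by
              simp only [hudef, gradient]
              rw [InnerProductSpace.toDual_symm_apply]
            rw [this, he, EuclideanSpace.inner_single_right]
            simp
          have hgs : gradient P x = ∑ i, (gradient P x) i • e i := by
            ext j
            fin_cases j <;> simp [he, Fin.sum_univ_three]
          have hsum : ∑ i, -(lineDeriv ℝ g x (e i) * u i x) = - fderiv ℝ g x (gradient P x) := by
            conv_rhs => rw [hgs, map_sum]
            rw [← Finset.sum_neg_distrib]
            refine Finset.sum_congr rfl fun i _ => ?_
            rw [hder.differentiableAt.lineDeriv_eq_fderiv, map_smul, hpu, smul_eq_mul, mul_comm]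
          rw [hsum]
          have hn : ‖fderiv ℝ g x‖ = k * ‖x‖ ^ (-k - 1) := by
            rw [hder.fderiv, norm_smul, norm_fderiv_norm hnd, norm_mul, norm_neg,
              Real.norm_of_nonneg (by linarith : 0 ≤ k), Real.norm_of_nonneg (by positivity), mul_one]
          calc - fderiv ℝ g x (gradient P x) ≤ ‖fderiv ℝ g x (gradient P x)‖ := neg_le_abs _
            _ ≤ ‖fderiv ℝ g x‖ * ‖gradient P x‖ := ContinuousLinearMap.le_opNorm _ _
            _ ≤ ‖fderiv ℝ g x‖ * d := by gcongr; exact hgrad x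
            _ = _ := by rw [hn, mul_comm]
        · rw [hconst 0]
          · rw [Set.indicator_of_notMem (fun h => lt_asymm h2 h.2)]; simp
          · filter_upwards [continuousAt_const.eventually_lt continuous_norm.continuousAt h2]
              with y hy
            exact hgR y hy.le
    _ ≤ 4 * Real.pi * d * (k / (k - 2)) := by
        rw [integral_const_mul]
        calc _ ≤ d * (4 * Real.pi * (k / (k - 2))) := by gcongr
          _ = _ := by ring

/-- Weighted integral bound on the Laplacian of a convex
function with bounded gradient, outside a ball. -/
theorem stmt_12 (P : EuclideanSpace ℝ (Fin 3) → ℝ)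
    (hP : ContDiff ℝ 2 P) (hconv : ConvexOn ℝ Set.univ P)
    (d : ℝ) (hgrad : ∀ x, ‖gradient P x‖ ≤ d)
    (K M : ℝ) (hK : 4 < K) (hM : 1 ≤ M) :
    ∫ x in {x : EuclideanSpace ℝ (Fin 3) | M < ‖x‖},
        ‖x‖ ^ (-(K / 2)) *
          ∑ i : Fin 3, fderiv ℝ (fun y => fderiv ℝ P y (EuclideanSpace.single i 1)) x
            (EuclideanSpace.single i 1)
      ≤ 4 * Real.pi * d * K / (K - 4) := by
  have hd0 : 0 ≤ d := le_trans (norm_nonneg _) (hgrad 0)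
  have hK4 : 0 < K - 4 := by linarith
  have hM0 : 0 < M := by linarith
  set L : E3 → ℝ := fun x =>
    ∑ i : Fin 3, fderiv ℝ (fun y => fderiv ℝ P y (EuclideanSpace.single i 1)) x
            (EuclideanSpace.single i 1) with hL
  have hL0 : ∀ x, 0 ≤ L x := fun x =>
    Finset.sum_nonneg fun i _ => aux_second_nonneg P hP hconv x _
  have hLc : Continuous L := by
    refine continuous_finsetSum _ fun i _ => ?_
    have hu : ContDiff ℝ 1 (fun y => fderiv ℝ P y (EuclideanSpace.single i 1)) :=
      (hP.fderiv_right (m := 1) (by norm_num)).clm_apply contDiff_const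
    exact (hu.continuous_fderiv (by norm_num)).clm_apply continuous_const
  have hA : MeasurableSet {x : E3 | M < ‖x‖} := measurableSet_lt measurable_const measurable_norm
  change ∫ x in {x : E3 | M < ‖x‖}, ‖x‖ ^ (-(K / 2)) * L x ≤ _
  by_cases hint : IntegrableOn (fun x => ‖x‖ ^ (-(K / 2)) * L x) {x : E3 | M < ‖x‖}
  swap
  · rw [integral_undef hint]; positivity
  have hlim : Filter.Tendsto (fun R : ℝ => ∫ x in {x : E3 | M < ‖x‖},
      ((max M (min ‖x‖ R)) ^ (-(K / 2)) - R ^ (-(K / 2))) * L x) Filter.atTop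
      (nhds (∫ x in {x : E3 | M < ‖x‖}, ‖x‖ ^ (-(K / 2)) * L x)) := by
    apply tendsto_integral_filter_of_dominated_convergence _ _ _ hint
    · refine (ae_restrict_iff' hA).2 (Filter.Eventually.of_forall fun x hx => ?_)
      have hx : M < ‖x‖ := hx
      have h0 : Filter.Tendsto (fun R : ℝ => (‖x‖ ^ (-(K / 2)) - R ^ (-(K / 2))) * L x)
          Filter.atTop (nhds ((‖x‖ ^ (-(K / 2)) - 0) * L x)) :=
        ((tendsto_rpow_neg_atTop (by linarith : 0 < K / 2)).const_sub _).mul_const _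
      rw [sub_zero] at h0
      refine h0.congr' ?_
      filter_upwards [Filter.eventually_ge_atTop ‖x‖] with R hR
      rw [min_eq_left hR, max_eq_right hx.le]
    · filter_upwards with R
      have := (aux_lip (K / 2) M R (by linarith) hM).continuous
      exact (this.mul hLc).aestronglyMeasurable
    · filter_upwards [Filter.eventually_gt_atTop M] with R hR
      refine (ae_restrict_iff' hA).2 (Filter.Eventually.of_forall fun x hx => ?_)
      have hx : M < ‖x‖ := hx
      have hx0 : 0 < ‖x‖ := hM0.trans hx
      have hR0 : 0 < R := hM0.trans hR
      rw [norm_mul, Real.norm_of_nonneg (hL0 x)]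
      refine mul_le_mul_of_nonneg_right ?_ (hL0 x)
      have a1 : 0 ≤ R ^ (-(K / 2)) := by positivity
      have a2 : 0 ≤ ‖x‖ ^ (-(K / 2)) := by positivity
      rcases le_total ‖x‖ R with h | h
      · rw [min_eq_left h, max_eq_right hx.le]
        have := Real.rpow_le_rpow_of_nonpos hx0 h (by linarith : -(K / 2) ≤ 0)
        rw [Real.norm_of_nonneg (by linarith)]
        linarith
      · rw [min_eq_right h, max_eq_right hR.le]
        simpa using a2
  refine le_of_tendsto hlim ?_
  filter_upwards [Filter.eventually_gt_atTop M] with R hR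
  have := aux_main P hP hconv d hgrad (K / 2) M R (by linarith) hM hR
  refine this.trans (le_of_eq ?_)
  have h2 : K / 2 - 2 ≠ 0 := by intro h; linarith
  have h3 : K - 4 ≠ 0 := hK4.ne'
  rw [show K / 2 - 2 = (K - 4) / 2 by ring]
  field_simp
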